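/- arXiv:1606.07844 — 2 statements merged into one kernel-verified Lean document; each statement's English description precedes it below -/
import Mathlib

section
/- Let m and n be positive integers with m ∣ n, let χ be a nontrivial Dirichlet character modulo m with values in ℂ, and let χ* denote the imprimitive character modulo n associated to χ, i.e. the function on integers given by χ*(a) = χ(a) if gcd(a, n) = 1 and χ*(a) = 0 otherwise. Then ∑_{a=0}^{n-1} χ*(a) · (a/n) = (∑_{d ∣ (n/m)} μ(d) χ(d)) · (∑_{s=0}^{m-1} χ(s) · (s/m)), where μ is the Möbius function. -/
theorem aux_sum_zero (m : ℕ) (hm : 0 < m) (χ : DirichletCharacter ℂ m) (hχ : χ ≠ 1) :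
    ∑ s ∈ Finset.range m, χ (s : ZMod m) = 0 := by
  haveI : NeZero m := ⟨hm.ne'⟩
  rw [← MulChar.sum_eq_zero_of_ne_one hχ]
  refine Finset.sum_bij (fun s _ => (s : ZMod m)) (fun _ _ => Finset.mem_univ _) ?_ ?_
    (fun _ _ => rfl)
  · intro a ha b hb h
    rw [Finset.mem_range] at ha hb
    have := congrArg ZMod.val h
    rwa [ZMod.val_cast_of_lt ha, ZMod.val_cast_of_lt hb] at this
  · intro b _
    exact ⟨b.val, Finset.mem_range.2 (ZMod.val_lt b), ZMod.natCast_zmod_val b⟩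

theorem aux_sum_mul (m : ℕ) (hm : 0 < m) (χ : DirichletCharacter ℂ m) (hχ : χ ≠ 1) (l : ℕ) :
    ∑ b ∈ Finset.range (m * l), χ (b : ZMod m) * (b : ℂ) =
      l * ∑ s ∈ Finset.range m, χ (s : ZMod m) * (s : ℂ) := by
  induction l with
  | zero => simp
  | succ l ih =>
    rw [Nat.mul_succ, Finset.sum_range_add, ih]
    have : ∀ x ∈ Finset.range m, χ ((m * l + x : ℕ) : ZMod m) * ((m * l + x : ℕ) : ℂ) =
        (m * l : ℂ) * χ (x : ZMod m) + χ (x : ZMod m) * (x : ℂ) := by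
      intro x _
      push_cast
      rw [ZMod.natCast_self, zero_mul, zero_add]
      ring
    rw [Finset.sum_congr rfl this, Finset.sum_add_distrib, ← Finset.mul_sum,
      aux_sum_zero m hm χ hχ]
    push_cast
    ring

open ArithmeticFunction in
theorem aux_moebius (a k : ℕ) (hk : 0 < k) :
    (if Nat.gcd a k = 1 then (1 : ℂ) else 0) =
      ∑ d ∈ k.divisors, if d ∣ a then (moebius d : ℂ) else 0 := by
  have h : ∑ d ∈ (Nat.gcd a k).divisors, moebius d = if Nat.gcd a k = 1 then 1 else 0 := by
    rw [← coe_mul_zeta_apply, moebius_mul_coe_zeta, one_apply]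
  rw [← Finset.sum_filter]
  have h2 : k.divisors.filter (· ∣ a) = (Nat.gcd a k).divisors := by
    ext d
    have : Nat.gcd a k ≠ 0 := (Nat.gcd_pos_of_pos_right _ hk).ne'
    simp only [Finset.mem_filter, Nat.mem_divisors, Nat.dvd_gcd_iff]
    have hk0 := hk.ne'
    tauto
  rw [h2]
  have h3 := congrArg (fun z : ℤ => (z : ℂ)) h
  push_cast at h3
  exact h3.symm

open ArithmeticFunction in
/-- Let `m ∣ n` be positive integers, `χ` a nontrivial Dirichlet character
modulo `m` with values in `ℂ`, and let `χ*` be the associated imprimitive character modulo `n`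
(i.e. `χ*(a) = χ(a)` if `gcd(a,n) = 1` and `χ*(a) = 0` otherwise). Then
`∑_{a=0}^{n-1} χ*(a)·(a/n) = (∑_{d ∣ n/m} μ(d) χ(d)) · (∑_{s=0}^{m-1} χ(s)·(s/m))`. -/
theorem sum_imprimitive_dirichlet_frac_eq (m n : ℕ) (hm : 0 < m) (hn : 0 < n) (hdvd : m ∣ n)
    (χ : DirichletCharacter ℂ m) (hχ : χ ≠ 1) :
    ∑ a ∈ Finset.range n, (if Nat.gcd a n = 1 then χ (a : ZMod m) else 0) * ((a : ℂ) / (n : ℂ)) =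
      (∑ d ∈ (n / m).divisors, (moebius d : ℂ) * χ (d : ZMod m)) *
        ∑ s ∈ Finset.range m, χ (s : ZMod m) * ((s : ℂ) / (m : ℂ)) := by
  obtain ⟨k, rfl⟩ := hdvd
  have hk : 0 < k := Nat.pos_of_mul_pos_left hn
  rw [Nat.mul_div_cancel_left k hm]
  have h1 : ∀ a ∈ Finset.range (m * k),
      (if Nat.gcd a (m * k) = 1 then χ (a : ZMod m) else 0) * ((a : ℂ) / ((m * k : ℕ) : ℂ)) =
      ∑ d ∈ k.divisors, (moebius d : ℂ) *
        (if d ∣ a then χ (a : ZMod m) * ((a : ℂ) / ((m * k : ℕ) : ℂ)) else 0) := by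
    intro a _
    have : (if Nat.gcd a (m * k) = 1 then χ (a : ZMod m) else 0) =
        (if Nat.gcd a k = 1 then (1 : ℂ) else 0) * χ (a : ZMod m) := by
      by_cases ha : Nat.Coprime a m
      · have : Nat.gcd a (m * k) = 1 ↔ Nat.gcd a k = 1 := by
          change Nat.Coprime a (m * k) ↔ Nat.Coprime a k
          rw [Nat.coprime_mul_iff_right]
          tauto
        simp [this]
      · have : χ (a : ZMod m) = 0 :=
          χ.map_nonunit (fun h => ha ((ZMod.isUnit_iff_coprime a m).1 h))
        simp [this]
    rw [this, aux_moebius a k hk, mul_assoc, Finset.sum_mul]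
    refine Finset.sum_congr rfl fun d _ => ?_
    split_ifs <;> simp
  rw [Finset.sum_congr rfl h1, Finset.sum_comm, Finset.sum_mul]
  refine Finset.sum_congr rfl fun d hd => ?_
  rw [← Finset.mul_sum, mul_assoc]
  congr 1
  obtain ⟨l, rfl⟩ := Nat.dvd_of_mem_divisors hd
  have hd0 : 0 < d := Nat.pos_of_mul_pos_right hk
  have hl0 : 0 < l := Nat.pos_of_mul_pos_left hk
  rw [← Finset.sum_filter]
  have h2 : (Finset.range (m * (d * l))).filter (d ∣ ·) =
      (Finset.range (m * l)).image (d * ·) := by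
    ext a
    simp only [Finset.mem_filter, Finset.mem_range, Finset.mem_image]
    constructor
    · rintro ⟨h, b, rfl⟩
      refine ⟨b, ?_, rfl⟩
      rw [Nat.mul_left_comm] at h
      exact Nat.lt_of_mul_lt_mul_left h
    · rintro ⟨b, h, rfl⟩
      refine ⟨?_, dvd_mul_right _ _⟩
      rw [Nat.mul_left_comm]
      exact Nat.mul_lt_mul_of_pos_left h hd0
  rw [h2, Finset.sum_image (fun x _ y _ h => Nat.eq_of_mul_eq_mul_left hd0 h)]
  have hm' : (m : ℂ) ≠ 0 := by exact_mod_cast hm.ne'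
  have hd' : (d : ℂ) ≠ 0 := by exact_mod_cast hd0.ne'
  have hl' : (l : ℂ) ≠ 0 := by exact_mod_cast hl0.ne'
  have h3 : ∀ b ∈ Finset.range (m * l),
      χ ((d * b : ℕ) : ZMod m) * (((d * b : ℕ) : ℂ) / ((m * (d * l) : ℕ) : ℂ)) =
      (χ (d : ZMod m) / (m * l)) * (χ (b : ZMod m) * (b : ℂ)) := by
    intro b _
    push_cast
    rw [map_mul]
    field_simp
  rw [Finset.sum_congr rfl h3, ← Finset.mul_sum, aux_sum_mul m hm χ hχ]
  simp only [← mul_div_assoc]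
  rw [← Finset.sum_div]
  field_simp
end

section
/- Let p be an odd prime and r ≥ 1 an integer. Then ∑_{x=1}^{2p^r} {−x²/(4p^r)} = p^r − {p^r/4} · p^⌊r/2⌋ + ((p^⌊(r+1)/2⌋ − 1)/(2(p − 1))) · ( (1/2)(1 − (−1)^{(p−1)/2}) + (3 − (2|p)) · h_p^* + h_p' ), where h_p^* := −∑_{a=0}^{p−1} (a|p) · (a/p) and h_p' := −∑_{0 < a < 4p, a odd} (−1)^{(a−1)/2} (a|p) · (a/(4p)). -/
/-- `h_p^* = -∑_{a=0}^{p-1} (a|p)·(a/p)`, where `(a|p)` is the Legendre symbol. -/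
def hpStar (p : ℕ) [Fact p.Prime] : ℚ :=
  -∑ a ∈ Finset.range p, (legendreSym p a : ℚ) * ((a : ℚ) / p)

/-- `h_p' = -∑_{0<a<4p, a odd} (-1)^((a-1)/2)·(a|p)·(a/(4p))`. -/
def hpPrime (p : ℕ) [Fact p.Prime] : ℚ :=
  -∑ a ∈ (Finset.range (4 * p)).filter (fun a => Odd a),
      (-1 : ℚ) ^ ((a - 1) / 2) * (legendreSym p a : ℚ) * ((a : ℚ) / (4 * p))

open Finset in
lemma tw_range_zmod (p : ℕ) [NeZero p] (g : ℕ → ℚ) :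
    ∑ t ∈ range p, g t = ∑ z : ZMod p, g z.val := by
  refine Finset.sum_bij' (fun t _ => (t : ZMod p)) (fun z _ => z.val) ?_ ?_ ?_ ?_ ?_
  · simp
  · intro z _; simpa using ZMod.val_lt z
  · intro t ht; simpa using ZMod.val_cast_of_lt (by simpa using ht)
  · intro z _; simp
  · intro t ht; rw [ZMod.val_cast_of_lt (by simpa using ht)]

lemma tw_per {p : ℕ} {f : ℤ → ℚ} (hf : ∀ n k : ℤ, f (n + p * k) = f n) {m n : ℤ}
    (h : (m : ZMod p) = n) : f m = f n := by
  rw [ZMod.intCast_eq_intCast_iff_dvd_sub] at h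
  obtain ⟨k, hk⟩ := h
  rw [show n = m + p * k by linarith, hf]

open Finset in
lemma tw_reindex (p : ℕ) [Fact p.Prime] (f : ℤ → ℚ) (hf : ∀ n k : ℤ, f (n + p * k) = f n)
    (a b : ℤ) (ha : (a : ZMod p) ≠ 0) :
    ∑ t ∈ range p, f (a * t + b) = ∑ t ∈ range p, f t := by
  rw [tw_range_zmod p (fun t => f (a * t + b)), tw_range_zmod p (fun t => f t)]
  let e : ZMod p ≃ ZMod p := (Equiv.mulLeft₀ (a : ZMod p) ha).trans (Equiv.addRight (b : ZMod p))
  refine Fintype.sum_equiv e _ _ ?_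
  intro z
  apply tw_per hf
  simp [e]

open Finset in
lemma tw_hermite (p : ℕ) [Fact p.Prime] (u : ℚ) (a : ℤ) (ha : (a : ZMod p) ≠ 0) :
    ∑ t ∈ range p, (Int.fract ((u + ((a * t : ℤ) : ℚ)) / p) - 1 / 2) = Int.fract u - 1 / 2 := by
  have hp : (0 : ℚ) < p := by exact_mod_cast (Fact.out : p.Prime).pos
  have h := tw_reindex p (fun n => Int.fract ((Int.fract u + (n : ℚ)) / p) - 1 / 2) ?_ a ⌊u⌋ ha
  · have h1 : ∀ t ∈ range p, (Int.fract ((u + ((a * t : ℤ) : ℚ)) / p) - 1 / 2) =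
        Int.fract ((Int.fract u + ((a * t + ⌊u⌋ : ℤ) : ℚ)) / p) - 1 / 2 := by
      intro t _
      congr 3
      push_cast
      linarith [Int.fract_add_floor u]
    rw [sum_congr rfl h1, h]
    have h2 : ∀ t ∈ range p, Int.fract ((Int.fract u + ((t : ℤ) : ℚ)) / p) - 1 / 2 =
        (Int.fract u + t) / p - 1 / 2 := by
      intro t ht
      have ht' : (t : ℚ) + 1 ≤ p := by exact_mod_cast (mem_range.1 ht)
      rw [Int.fract_eq_self.2]
      · simp
      · constructor
        · have := Int.fract_nonneg u
          positivity
        · rw [div_lt_one hp]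
          have := Int.fract_lt_one u
          push_cast
          linarith
    rw [sum_congr rfl h2, sum_sub_distrib, ← sum_div, sum_add_distrib, ← Nat.cast_sum]
    have h3 : ((∑ t ∈ range p, t : ℕ) : ℚ) * 2 = p * (p - 1) := by
      have := Finset.sum_range_id_mul_two p
      have h4 : 1 ≤ p := (Fact.out : p.Prime).pos
      rw [← Nat.cast_pred (by omega)]
      exact_mod_cast this
    have h3' : ((∑ t ∈ range p, t : ℕ) : ℚ) = p * (p - 1) / 2 := by linarith
    rw [h3']
    simp
    field_simp
    ring
  · intro n k
    have : (Int.fract u + ((n + p * k : ℤ) : ℚ)) / p = (Int.fract u + n) / p + (k : ℤ) := by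
      push_cast
      field_simp
      ring
    simp only [this, Int.fract_add_intCast]

open Finset in
lemma tw_sq (p : ℕ) [Fact p.Prime] (hp2 : p ≠ 2) (f : ℤ → ℚ)
    (hf : ∀ n k : ℤ, f (n + p * k) = f n) :
    ∑ z ∈ range p, f ((z : ℤ) ^ 2) = ∑ a ∈ range p, (1 + (legendreSym p a : ℚ)) * f a := by
  rw [tw_range_zmod p (fun z => f ((z : ℤ) ^ 2)),
    tw_range_zmod p (fun a => (1 + (legendreSym p a : ℚ)) * f a)]
  have h1 : ∀ z : ZMod p, f ((z.val : ℤ) ^ 2) = f ((z ^ 2).val) := by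
    intro z
    apply tw_per hf
    simp
  rw [Fintype.sum_congr _ _ h1]
  rw [← Finset.sum_fiberwise_of_maps_to (s := univ) (t := univ) (g := fun z : ZMod p => z ^ 2)
    (by simp)]
  refine Fintype.sum_congr _ _ fun a => ?_
  have h2 : ∀ z ∈ univ.filter (fun z : ZMod p => z ^ 2 = a), f ((z ^ 2).val) = f a.val := by
    intro z hz
    rw [(mem_filter.1 hz).2]
  rw [sum_congr rfl h2, sum_const, nsmul_eq_mul]
  congr 1
  have h3 := legendreSym.card_sqrts p hp2 (a.val : ℤ)
  have h4 : (({x : ZMod p | x ^ 2 = (((a.val : ℤ) : ZMod p))} : Set (ZMod p)).toFinset) =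
      univ.filter (fun z : ZMod p => z ^ 2 = a) := by
    ext x; simp
  rw [h4] at h3
  have h5 : ((univ.filter (fun z : ZMod p => z ^ 2 = a)).card : ℚ) =
    (((univ.filter (fun z : ZMod p => z ^ 2 = a)).card : ℤ) : ℚ) := by simp
  rw [h5, h3]
  push_cast
  ring

open Finset in
lemma tw_range_mul (m n : ℕ) (f : ℕ → ℚ) :
    ∑ x ∈ range (m * n), f x = ∑ j ∈ range m, ∑ b ∈ range n, f (n * j + b) := by
  induction m with
  | zero => simp
  | succ m ih => rw [Nat.succ_mul, sum_range_add, ih, sum_range_succ, mul_comm n m]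

lemma tw_chi_per (p : ℕ) [Fact p.Prime] (n k : ℤ) :
    (legendreSym p (n + p * k) : ℚ) = legendreSym p n := by
  rw [legendreSym.mod p (n + p * k), legendreSym.mod p n]
  simp

open Finset in
lemma tw_chi_sum (p : ℕ) [Fact p.Prime] (hp2 : p ≠ 2) (a b : ℤ) (ha : (a : ZMod p) ≠ 0) :
    ∑ t ∈ range p, (legendreSym p (a * t + b) : ℚ) = 0 := by
  rw [tw_reindex p (fun n => (legendreSym p n : ℚ)) (tw_chi_per p) a b ha]
  have := tw_sq p hp2 (fun _ => 1) (by simp)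
  simp [sum_add_distrib] at this
  exact_mod_cast this

lemma tw_chi_fract (p : ℕ) [Fact p.Prime] (m : ℕ) (hm : 0 < m) (n : ℕ) (hn : n < m * p) :
    (legendreSym p n : ℚ) * Int.fract (-(n : ℚ) / (m * p)) =
      (legendreSym p n : ℚ) * (1 - n / (m * p)) := by
  rcases Nat.eq_zero_or_pos n with h | h
  · subst h; simp [legendreSym.at_zero]
  · congr 1
    have hp : (0 : ℚ) < p := by exact_mod_cast (Fact.out : p.Prime).pos
    have hm' : (0 : ℚ) < m := by exact_mod_cast hm
    have hn' : (n : ℚ) < m * p := by exact_mod_cast hn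
    have h' : (0 : ℚ) < n := by exact_mod_cast h
    rw [show -(n : ℚ) / (m * p) = (1 - n / (m * p)) - (1 : ℤ) by push_cast; ring,
      Int.fract_sub_intCast, Int.fract_eq_self.2]
    have h1 : (n : ℚ) / (m * p) < 1 := by rw [div_lt_one (by positivity)]; exact hn'
    have h2 : 0 < (n : ℚ) / (m * p) := by positivity
    constructor <;> linarith

open Finset in
lemma tw_hstar_mul (p : ℕ) [Fact p.Prime] (hp2 : p ≠ 2) (m : ℕ) (hm : 0 < m) :
    ∑ x ∈ range (m * p), (legendreSym p x : ℚ) * (x / (m * p)) = - hpStar p := by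
  have hp : (0 : ℚ) < p := by exact_mod_cast (Fact.out : p.Prime).pos
  have hm' : (0 : ℚ) < m := by exact_mod_cast hm
  rw [tw_range_mul, hpStar, neg_neg]
  have h : ∀ j ∈ range m, ∑ b ∈ range p, (legendreSym p ((p * j + b : ℕ) : ℤ) : ℚ) *
      (((p * j + b : ℕ) : ℚ) / (m * p)) =
      (∑ a ∈ range p, (legendreSym p a : ℚ) * ((a : ℚ) / p)) / m := by
    intro j _
    have h0 := tw_chi_sum p hp2 1 0 (by simp)
    simp only [one_mul, add_zero] at h0
    have : ∀ b ∈ range p, (legendreSym p ((p * j + b : ℕ) : ℤ) : ℚ) *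
      (((p * j + b : ℕ) : ℚ) / (m * p)) =
      (legendreSym p b : ℚ) * (j / m) + (legendreSym p b : ℚ) * ((b : ℚ) / p) / m := by
      intro b _
      rw [show ((p * j + b : ℕ) : ℤ) = b + p * j by push_cast; ring, tw_chi_per]
      push_cast
      field_simp
    rw [sum_congr rfl this, sum_add_distrib, ← sum_mul, h0, zero_mul, zero_add, sum_div]
  rw [sum_congr rfl h]
  simp
  field_simp

open Finset in
lemma tw_range_two (n : ℕ) (f : ℕ → ℚ) :
    ∑ x ∈ range (2 * n), f x = ∑ j ∈ range n, (f (2 * j) + f (2 * j + 1)) := by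
  rw [mul_comm, tw_range_mul]
  simp [sum_range_succ]

/-- class 1 mod 4 -/
def twA (p : ℕ) [Fact p.Prime] : ℚ :=
  ∑ k ∈ Finset.range p, (legendreSym p (4 * k + 1) : ℚ) * ((4 * k + 1) / (4 * p))

/-- class 3 mod 4 -/
def twB (p : ℕ) [Fact p.Prime] : ℚ :=
  ∑ k ∈ Finset.range p, (legendreSym p (4 * k + 3) : ℚ) * ((4 * k + 3) / (4 * p))

open Finset in
lemma tw_hprime (p : ℕ) [Fact p.Prime] : hpPrime p = twB p - twA p := by
  rw [hpPrime, sum_filter, mul_comm 4 p, tw_range_mul]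
  rw [twA, twB, ← sum_sub_distrib, ← sum_neg_distrib]
  refine sum_congr rfl fun k _ => ?_
  have e1 : ¬ Odd (4 * k) := by rw [Nat.odd_iff]; omega
  have e2 : Odd (4 * k + 1) := by rw [Nat.odd_iff]; omega
  have e3 : ¬ Odd (4 * k + 2) := by rw [Nat.odd_iff]; omega
  have e4 : Odd (4 * k + 3) := by rw [Nat.odd_iff]; omega
  simp only [sum_range_succ, sum_range_zero, add_zero, e1, e2, e3, e4, if_true, if_false]
  rw [show (4 * k + 1 - 1) / 2 = 2 * k by omega, show (4 * k + 3 - 1) / 2 = 2 * k + 1 by omega,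
    pow_succ, pow_mul]
  push_cast
  norm_num
  ring

open Finset in
lemma tw_AB (p : ℕ) [Fact p.Prime] (hp2 : p ≠ 2) :
    twA p + twB p = - (1 - (legendreSym p 2 : ℚ)) * hpStar p := by
  have h4 := tw_hstar_mul p hp2 4 (by norm_num)
  have h2 := tw_hstar_mul p hp2 2 (by norm_num)
  rw [show 4 * p = 2 * (2 * p) by ring, tw_range_two, sum_add_distrib] at h4
  have e : ∑ j ∈ range (2 * p), (legendreSym p ((2 * j : ℕ) : ℤ) : ℚ) *
      (((2 * j : ℕ) : ℚ) / ((4 : ℕ) * p)) = (legendreSym p 2 : ℚ) * - hpStar p := by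
    rw [← h2, mul_sum]
    refine sum_congr rfl fun j _ => ?_
    have : legendreSym p ((2 * j : ℕ) : ℤ) = legendreSym p 2 * legendreSym p j := by
      push_cast
      exact legendreSym.mul p 2 j
    rw [this]
    push_cast
    rw [show (2 * (j : ℚ)) / (4 * p) = j / (2 * p) by
      rw [show (4 : ℚ) * p = 2 * (2 * p) by ring, mul_div_mul_left _ _ (by norm_num)]]
    ring
  rw [e, tw_range_two, sum_add_distrib] at h4
  have eA : twA p = ∑ x ∈ range p, (legendreSym p ((2 * (2 * x) + 1 : ℕ) : ℤ) : ℚ) *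
      (((2 * (2 * x) + 1 : ℕ) : ℚ) / ((4 : ℕ) * p)) := by
    refine sum_congr rfl fun j _ => ?_
    push_cast
    rw [show (2 : ℤ) * (2 * j) = 4 * j by ring, show (2 : ℚ) * (2 * j) = 4 * j by ring]
  have eB : twB p = ∑ x ∈ range p, (legendreSym p ((2 * (2 * x + 1) + 1 : ℕ) : ℤ) : ℚ) *
      (((2 * (2 * x + 1) + 1 : ℕ) : ℚ) / ((4 : ℕ) * p)) := by
    refine sum_congr rfl fun j _ => ?_
    push_cast
    rw [show (2 : ℤ) * (2 * j + 1) + 1 = 4 * j + 3 by ring,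
      show (2 : ℚ) * (2 * j + 1) + 1 = 4 * j + 3 by ring]
  rw [← eA, ← eB] at h4
  linarith

/-- the centered summand -/
def twE (p r : ℕ) (x : ℤ) : ℚ := Int.fract (-(x : ℚ) ^ 2 / (4 * (p : ℚ) ^ r)) - 1 / 2

lemma twE_per (p r : ℕ) (hp : 0 < p) (x k : ℤ) : twE p r (x + 2 * p ^ r * k) = twE p r x := by
  have hp : (0 : ℚ) < p := by exact_mod_cast hp
  unfold twE
  rw [show -((x + 2 * p ^ r * k : ℤ) : ℚ) ^ 2 / (4 * (p : ℚ) ^ r) =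
    -(x : ℚ) ^ 2 / (4 * (p : ℚ) ^ r) - ((x * k + p ^ r * k ^ 2 : ℤ) : ℚ) by
      push_cast; field_simp; ring, Int.fract_sub_intCast]

open Finset in
lemma tw_T1 (p : ℕ) [Fact p.Prime] (hp2 : p ≠ 2) (hodd : Odd p) :
    ∑ x ∈ range (2 * p), twE p 1 x = hpStar p - 1 / 4 - twA p := by
  have hp : (0 : ℚ) < p := by exact_mod_cast (Fact.out : p.Prime).pos
  obtain ⟨s, hs⟩ := hodd
  have hsQ : (p : ℚ) = 2 * s + 1 := by exact_mod_cast hs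
  have hsZ : (p : ℤ) = 2 * s + 1 := by exact_mod_cast hs
  have four : ((4 : ℤ) : ZMod p) ≠ 0 := by
    intro h
    rw [ZMod.intCast_zmod_eq_zero_iff_dvd] at h
    have h' : p ∣ 2 ^ 2 := by exact_mod_cast h
    exact hp2 ((Nat.prime_dvd_prime_iff_eq Fact.out Nat.prime_two).1
      ((Fact.out : p.Prime).dvd_of_dvd_pow h'))
  have mone : ((-1 : ℤ) : ZMod p) ≠ 0 := by simp
  rw [tw_range_two, sum_add_distrib]
  have hev : ∑ j ∈ range p, twE p 1 ((2 * j : ℕ) : ℤ) = hpStar p - 1 / 2 := by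
    have h1 := tw_sq p hp2 (fun n => Int.fract (-(n : ℚ) / p) - 1 / 2) (by
      intro n k
      have : -((n + p * k : ℤ) : ℚ) / p = -(n : ℚ) / p - (k : ℤ) := by
        push_cast; field_simp; ring
      simp only [this, Int.fract_sub_intCast])
    have h2 : ∑ j ∈ range p, twE p 1 ((2 * j : ℕ) : ℤ) =
        ∑ z ∈ range p, (Int.fract (-(((z : ℤ) ^ 2 : ℤ) : ℚ) / p) - 1 / 2) := by
      refine sum_congr rfl fun j _ => ?_
      unfold twE
      congr 2
      push_cast
      field_simp
      ring
    rw [h2, h1]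
    simp only [add_mul, one_mul, sum_add_distrib]
    have h3 := tw_hermite p 0 (-1) mone
    simp only [Int.fract_zero] at h3
    have h4 : ∑ t ∈ range p, (Int.fract (-((t : ℤ) : ℚ) / p) - 1 / 2) = 0 - 1 / 2 := by
      rw [← h3]
      refine sum_congr rfl fun t _ => ?_
      push_cast
      congr 3
      ring
    rw [h4]
    have h0 := tw_chi_sum p hp2 1 0 (by simp)
    simp only [one_mul, add_zero] at h0
    have h5 : ∀ a ∈ range p, (legendreSym p a : ℚ) * (Int.fract (-((a : ℤ) : ℚ) / p) - 1 / 2) =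
        (legendreSym p a : ℚ) * (1 / 2) - (legendreSym p a : ℚ) * ((a : ℚ) / p) := by
      intro a ha
      have := tw_chi_fract p 1 one_pos a (by simpa using ha)
      simp only [Nat.cast_one, one_mul] at this
      rw [mul_sub, Int.cast_natCast, this]
      ring
    rw [sum_congr rfl h5, sum_sub_distrib, ← sum_mul, h0, hpStar]
    ring
  have hod : ∑ j ∈ range p, twE p 1 ((2 * j + 1 : ℕ) : ℤ) = 1 / 4 - twA p := by
    have h1 := tw_sq p hp2 (fun n => Int.fract (-(n : ℚ) / p - p / 4) - 1 / 2) (by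
      intro n k
      have : -((n + p * k : ℤ) : ℚ) / p - p / 4 = -(n : ℚ) / p - p / 4 - (k : ℤ) := by
        push_cast; field_simp; ring
      simp only [this, Int.fract_sub_intCast])
    have h2 : ∑ j ∈ range p, twE p 1 ((2 * j + 1 : ℕ) : ℤ) =
        ∑ z ∈ range p, (Int.fract (-(((z : ℤ) ^ 2 : ℤ) : ℚ) / p - p / 4) - 1 / 2) := by
      have h3 := tw_reindex p (fun n => twE p 1 (2 * n + 1)) (by
        intro n k
        rw [← twE_per p 1 (Fact.out : p.Prime).pos (2 * n + 1) k]
        congr 1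
        ring) 1 s (by simp)
      have h3' : ∀ t : ℕ, ((2 * t + 1 : ℕ) : ℤ) = 2 * t + 1 := by intro t; push_cast; ring
      simp only [h3']
      rw [← h3]
      refine sum_congr rfl fun j _ => ?_
      unfold twE
      rw [show 2 * (1 * (j : ℤ) + s) + 1 = 2 * j + p by rw [hsZ]; ring]
      rw [show -((2 * j + p : ℤ) : ℚ) ^ 2 / (4 * (p : ℚ) ^ 1) =
        (-(((j : ℤ) ^ 2 : ℤ) : ℚ) / p - p / 4) - (j : ℤ) by push_cast; field_simp; ring,
        Int.fract_sub_intCast]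
    rw [h2, h1]
    simp only [add_mul, one_mul, sum_add_distrib]
    have h3 := tw_hermite p (-(p : ℚ) ^ 2 / 4) (-1) mone
    have h4 : ∑ t ∈ range p, (Int.fract (-((t : ℤ) : ℚ) / p - p / 4) - 1 / 2) = 1 / 4 := by
      have h5 : Int.fract (-(p : ℚ) ^ 2 / 4) = 3 / 4 := by
        rw [show -(p : ℚ) ^ 2 / 4 = 3 / 4 - ((s ^ 2 + s + 1 : ℤ) : ℚ) by
          rw [hsQ]; push_cast; ring, Int.fract_sub_intCast, Int.fract_eq_self.2]
        norm_num
      rw [h5] at h3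
      rw [show (1 / 4 : ℚ) = 3 / 4 - 1 / 2 by norm_num, ← h3]
      refine sum_congr rfl fun t _ => ?_
      push_cast
      congr 2
      field_simp
      ring
    rw [h4]
    have h5 := tw_reindex p (fun n => (legendreSym p (4 * n + 1) : ℚ) *
        (Int.fract (-(4 * n + 1 : ℚ) / (4 * p)) - 1 / 2)) (by
        intro n k
        have e1 : (4 : ℤ) * (n + p * k) + 1 = (4 * n + 1) + p * (4 * k) := by ring
        have e2 : -(4 * ((n + p * k : ℤ) : ℚ) + 1) / (4 * p) =
          -(4 * n + 1 : ℚ) / (4 * p) - (k : ℤ) := by push_cast; field_simp; ring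
        simp only [e1, tw_chi_per, e2, Int.fract_sub_intCast]) 1 (s ^ 2 + s) (by simp)
    have h6 : ∀ a ∈ range p, (legendreSym p a : ℚ) *
        (Int.fract (-((a : ℤ) : ℚ) / p - p / 4) - 1 / 2) =
        (legendreSym p (4 * (1 * a + (s ^ 2 + s)) + 1) : ℚ) *
        (Int.fract (-(4 * ((1 * a + (s ^ 2 + s) : ℤ) : ℚ) + 1) / (4 * p)) - 1 / 2) := by
      intro a _
      congr 1
      · rw [show 4 * (1 * (a : ℤ) + (s ^ 2 + s)) + 1 = 2 ^ 2 * a + p * p by rw [hsZ]; ring,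
          tw_chi_per, legendreSym.mul, legendreSym.sq_one']
        · simp
        · intro h
          apply four
          have : ((2 : ℤ) : ZMod p) ^ 2 = 0 := by rw [h]; simp
          push_cast at this ⊢
          linear_combination this
      · congr 2
        push_cast
        field_simp
        rw [hsQ]
        ring
    rw [sum_congr rfl h6, h5]
    have h0 := tw_chi_sum p hp2 4 1 four
    have h7 : ∀ a ∈ range p, (legendreSym p (4 * a + 1) : ℚ) *
        (Int.fract (-(4 * ((a : ℤ) : ℚ) + 1) / (4 * p)) - 1 / 2) =
        (legendreSym p (4 * a + 1) : ℚ) * (1 / 2) -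
          (legendreSym p (4 * a + 1) : ℚ) * ((4 * a + 1) / (4 * p)) := by
      intro a ha
      have ha' := mem_range.1 ha
      have := tw_chi_fract p 4 (by norm_num) (4 * a + 1) (by omega)
      push_cast at this
      rw [mul_sub, Int.cast_natCast, this]
      ring
    rw [sum_congr rfl h7, sum_sub_distrib, ← sum_mul, h0, twA]
    ring
  rw [hev, hod]
  ring

/-- sum over all residues -/
def twT (p r : ℕ) : ℚ := ∑ x ∈ Finset.range (2 * p ^ r), twE p r x

/-- sum over residues prime to p -/
def twV (p r : ℕ) : ℚ := ∑ x ∈ Finset.range (2 * p ^ r), if p ∣ x then 0 else twE p r x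

open Finset in
lemma tw_split (p r : ℕ) (hp : 0 < p) :
    twT p (r + 1) = twV p (r + 1) + ∑ y ∈ range (2 * p ^ r), twE p (r + 1) (p * y) := by
  unfold twT twV
  rw [show 2 * p ^ (r + 1) = 2 * p ^ r * p by ring, tw_range_mul (2 * p ^ r) p, tw_range_mul (2 * p ^ r) p,
    ← sum_add_distrib]
  refine sum_congr rfl fun y _ => ?_
  obtain ⟨q, rfl⟩ : ∃ q, p = q + 1 := ⟨p - 1, by omega⟩
  rw [sum_range_succ', sum_range_succ']
  have h : ∀ k ∈ range q, (if (q + 1) ∣ (q + 1) * y + (k + 1) then (0 : ℚ) else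
      twE (q + 1) (r + 1) (((q + 1) * y + (k + 1) : ℕ) : ℤ)) =
      twE (q + 1) (r + 1) (((q + 1) * y + (k + 1) : ℕ) : ℤ) := by
    intro k hk
    rw [if_neg]
    rw [Nat.dvd_add_right (dvd_mul_right _ _)]
    intro h
    have := Nat.le_of_dvd (by omega) h
    have := mem_range.1 hk
    omega
  rw [sum_congr rfl h]
  simp

open Finset in
lemma tw_rec (p r : ℕ) (hp : 0 < p) : twT p (r + 2) = twV p (r + 2) + p * twT p r := by
  rw [tw_split p (r + 1) hp]
  congr 1
  have hp' : (0 : ℚ) < p := by exact_mod_cast hp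
  rw [show 2 * p ^ (r + 1) = p * (2 * p ^ r) by ring, tw_range_mul p]
  have h : ∀ j ∈ range p, ∑ b ∈ range (2 * p ^ r),
      twE p (r + 1 + 1) (p * ((2 * p ^ r * j + b : ℕ) : ℤ)) = twT p r := by
    intro j _
    refine sum_congr rfl fun b _ => ?_
    rw [← twE_per p r hp b j]
    unfold twE
    congr 2
    push_cast
    field_simp
    ring
  rw [sum_congr rfl h]
  simp

open Finset in
lemma tw_V_step (p r : ℕ) [Fact p.Prime] : twV p (r + 2) = twV p (r + 1) := by
  have hp : (0 : ℚ) < p := by exact_mod_cast (Fact.out : p.Prime).pos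
  unfold twV
  rw [show 2 * p ^ (r + 2) = p * (2 * p ^ (r + 1)) by ring, tw_range_mul p, sum_comm]
  refine sum_congr rfl fun x _ => ?_
  have hd : ∀ j, p ∣ 2 * p ^ (r + 1) * j + x ↔ p ∣ x := by
    intro j
    apply Nat.dvd_add_right
    exact Dvd.dvd.mul_right (Dvd.dvd.mul_left (dvd_pow_self p (by omega)) 2) j
  simp only [hd]
  by_cases hx : p ∣ x
  · simp [hx]
  · simp only [hx, if_false]
    have h := tw_hermite p (-(x : ℚ) ^ 2 / (4 * (p : ℚ) ^ (r + 1))) (-x) (by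
      simpa [ZMod.natCast_eq_zero_iff] using hx)
    unfold twE
    rw [Int.cast_natCast, ← h]
    refine sum_congr rfl fun j _ => ?_
    congr 1
    rw [show -(((2 * p ^ (r + 1) * j + x : ℕ) : ℤ) : ℚ) ^ 2 / (4 * (p : ℚ) ^ (r + 2)) =
      (-(x : ℚ) ^ 2 / (4 * (p : ℚ) ^ (r + 1)) + ((-x * j : ℤ) : ℚ)) / p -
        ((p ^ r * j ^ 2 : ℤ) : ℚ) by push_cast; field_simp; ring, Int.fract_sub_intCast]

lemma tw_V_eq (p r : ℕ) [Fact p.Prime] : twV p (r + 1) = twV p 1 := by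
  induction r with
  | zero => rfl
  | succ r ih => rw [tw_V_step, ih]

lemma tw_fract_neg (p : ℕ) (hodd : Odd p) :
    Int.fract (-(p : ℚ) / 4) = 1 - Int.fract ((p : ℚ) / 4) := by
  rw [neg_div, Int.fract_neg]
  intro h
  obtain ⟨n, hn⟩ := Int.fract_eq_zero_iff.1 h
  have : (p : ℚ) = 4 * n := by linarith
  have h2 : (p : ℤ) = 4 * n := by exact_mod_cast this
  obtain ⟨s, hs⟩ := hodd
  omega

lemma tw_fract_four (p : ℕ) (hodd : Odd p) :
    Int.fract ((p : ℚ) / 4) = 1 / 2 - (-1 : ℚ) ^ ((p - 1) / 2) / 4 := by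
  obtain ⟨s, hs⟩ := hodd
  rcases Nat.even_or_odd' s with ⟨t, ht | ht⟩
  · rw [show (p - 1) / 2 = 2 * t by omega, pow_mul]
    have : (p : ℚ) / 4 = 1 / 4 + (t : ℤ) := by
      rw [hs, ht]; push_cast; ring
    rw [this, Int.fract_add_intCast, Int.fract_eq_self.2 (by norm_num)]
    norm_num
  · rw [show (p - 1) / 2 = 2 * t + 1 by omega, pow_succ, pow_mul]
    have : (p : ℚ) / 4 = 3 / 4 + (t : ℤ) := by
      rw [hs, ht]; push_cast; ring
    rw [this, Int.fract_add_intCast, Int.fract_eq_self.2 (by norm_num)]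
    norm_num

lemma tw_fract_step (p r : ℕ) (hodd : Odd p) :
    Int.fract ((p : ℚ) ^ (r + 2) / 4) = Int.fract ((p : ℚ) ^ r / 4) := by
  obtain ⟨s, hs⟩ := hodd
  have : (p : ℚ) ^ (r + 2) / 4 = (p : ℚ) ^ r / 4 + ((p ^ r * (s ^ 2 + s) : ℤ) : ℚ) := by
    have hsQ : (p : ℚ) = 2 * s + 1 := by exact_mod_cast hs
    push_cast
    rw [pow_add, hsQ]
    ring
  rw [this, Int.fract_add_intCast]

open Finset in
lemma tw_V1 (p : ℕ) [Fact p.Prime] (hp2 : p ≠ 2) (hodd : Odd p) :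
    twV p 1 = (1 / 2) * ((1 / 2) * (1 - (-1 : ℚ) ^ ((p - 1) / 2)) +
          (3 - (legendreSym p 2 : ℚ)) * hpStar p + hpPrime p) := by
  have hp : (0 : ℚ) < p := by exact_mod_cast (Fact.out : p.Prime).pos
  have h := tw_split p 0 (Fact.out : p.Prime).pos
  have h1 := tw_T1 p hp2 hodd
  have h2 : twT p (0 + 1) = ∑ x ∈ range (2 * p), twE p 1 x := by simp [twT]
  rw [h2, h1] at h
  have h3 : twE p (0 + 1) (p * (0 : ℕ)) = - 1 / 2 := by
    simp [twE]; norm_num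
  have h4 : twE p (0 + 1) (p * (1 : ℕ)) = 1 / 2 - Int.fract ((p : ℚ) / 4) := by
    unfold twE
    rw [show -((p * (1 : ℕ) : ℤ) : ℚ) ^ 2 / (4 * (p : ℚ) ^ (0 + 1)) = -(p : ℚ) / 4 by
      push_cast; field_simp, tw_fract_neg p hodd]
    ring
  simp only [pow_zero, mul_one, sum_range_succ, sum_range_zero, h3, h4] at h
  rw [tw_fract_four p hodd] at h
  have h5 := tw_AB p hp2
  rw [tw_hprime]
  simp only [zero_add] at h
  linarith

lemma tw_main (p : ℕ) [Fact p.Prime] (hodd : Odd p) (r : ℕ) :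
    twT p r = - Int.fract ((p : ℚ) ^ r / 4) * (p : ℚ) ^ (r / 2) +
      (((p : ℚ) ^ ((r + 1) / 2) - 1) / ((p : ℚ) - 1)) * twV p 1 := by
  have hp1 : (p : ℚ) - 1 ≠ 0 := by
    have : (1 : ℚ) < p := by exact_mod_cast (Fact.out : p.Prime).one_lt
    linarith
  have hp : (0 : ℚ) < p := by exact_mod_cast (Fact.out : p.Prime).pos
  induction r using Nat.twoStepInduction with
  | zero =>
    simp only [twT, pow_zero, mul_one, Finset.sum_range_succ, Finset.sum_range_zero, twE]
    have h1 : Int.fract (-(1 : ℚ) / 4) = 3 / 4 := by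
      rw [show (-(1 : ℚ) / 4) = 3 / 4 - (1 : ℤ) by norm_num, Int.fract_sub_intCast,
        Int.fract_eq_self.2 (by norm_num)]
    have h2 : Int.fract ((1 : ℚ) / 4) = 1 / 4 := Int.fract_eq_self.2 (by norm_num)
    norm_num at h1 h2 ⊢
  | one =>
    rw [tw_split p 0 (Fact.out : p.Prime).pos]
    have h3 : twE p (0 + 1) (p * (0 : ℕ)) = - 1 / 2 := by
      simp [twE]; norm_num
    have h4 : twE p (0 + 1) (p * (1 : ℕ)) = 1 / 2 - Int.fract ((p : ℚ) / 4) := by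
      unfold twE
      rw [show -((p * (1 : ℕ) : ℤ) : ℚ) ^ 2 / (4 * (p : ℚ) ^ (0 + 1)) = -(p : ℚ) / 4 by
        push_cast; field_simp, tw_fract_neg p hodd]
      ring
    simp only [pow_zero, mul_one, Finset.sum_range_succ, Finset.sum_range_zero, h3, h4]
    norm_num
    rw [div_self hp1]
    ring
  | more r ih _ =>
    rw [tw_rec p r (Fact.out : p.Prime).pos, ih, tw_fract_step p r hodd, tw_V_eq,
      show (r + 2) / 2 = r / 2 + 1 by omega, show (r + 2 + 1) / 2 = (r + 1) / 2 + 1 by omega,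
      pow_succ, pow_succ]
    field_simp
    ring

/-- For `p` an odd prime and `r ≥ 1`,
`∑_{x=1}^{2p^r} {-x²/(4p^r)} = p^r - {p^r/4}·p^⌊r/2⌋
  + ((p^⌊(r+1)/2⌋-1)/(2(p-1)))·((1/2)(1-(-1)^((p-1)/2)) + (3-(2|p))·h_p^* + h_p')`.
The left-hand side is the trace of the standard choice of exponents for the Weil
representation attached to `(ℤ/2p^rℤ, x ↦ x²/(4p^r))`. -/
theorem trace_exponents_weil (p : ℕ) [Fact p.Prime] (hodd : Odd p) (r : ℕ) (hr : 1 ≤ r) :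
    ∑ x ∈ Finset.Icc 1 (2 * p ^ r), Int.fract (-(x : ℚ) ^ 2 / (4 * (p : ℚ) ^ r)) =
      (p : ℚ) ^ r - Int.fract ((p : ℚ) ^ r / 4) * (p : ℚ) ^ (r / 2) +
      (((p : ℚ) ^ ((r + 1) / 2) - 1) / (2 * ((p : ℚ) - 1))) *
        ((1 / 2) * (1 - (-1 : ℚ) ^ ((p - 1) / 2)) +
          (3 - (legendreSym p 2 : ℚ)) * hpStar p + hpPrime p) := by
  have hp2 : p ≠ 2 := by
    rintro rfl
    exact absurd hodd (by decide)
  have h := tw_main p hodd r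
  rw [tw_V1 p hp2 hodd] at h
  have h1 : ∑ x ∈ Finset.Icc 1 (2 * p ^ r), Int.fract (-(x : ℚ) ^ 2 / (4 * (p : ℚ) ^ r)) =
      twT p r + (p : ℚ) ^ r := by
    have h2 : ∑ x ∈ Finset.Icc 1 (2 * p ^ r), Int.fract (-(x : ℚ) ^ 2 / (4 * (p : ℚ) ^ r)) =
        ∑ x ∈ Finset.range (2 * p ^ r), (twE p r ((x + 1 : ℕ) : ℤ) + 1 / 2) := by
      rw [Finset.range_eq_Ico, Finset.sum_Ico_add' (fun x : ℕ => twE p r (x : ℤ) + 1 / 2)]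
      refine Finset.sum_congr (by ext; simp [Nat.lt_succ_iff]) fun x _ => ?_
      simp [twE]
    have h3 := Finset.sum_range_succ (fun x : ℕ => twE p r (x : ℤ)) (2 * p ^ r)
    rw [Finset.sum_range_succ'] at h3
    have h4 := twE_per p r (Fact.out : p.Prime).pos 0 1
    have h5 : twE p r ((2 * p ^ r : ℕ) : ℤ) = twE p r ((0 : ℕ) : ℤ) := by
      rw [Nat.cast_zero, ← h4]
      congr 1
      push_cast
      ring
    rw [h2, Finset.sum_add_distrib, twT]
    have h6 : ∑ x ∈ Finset.range (2 * p ^ r), (1 / 2 : ℚ) = (p : ℚ) ^ r := by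
      simp [mul_comm]
    rw [h6]
    linarith
  rw [h1, h]
  have hp1 : (p : ℚ) - 1 ≠ 0 := by
    have : (1 : ℚ) < p := by exact_mod_cast (Fact.out : p.Prime).one_lt
    linarith
  rw [mul_comm (2 : ℚ) ((p : ℚ) - 1), ← div_div]
  ring
end
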